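/- arXiv:1108.4873 — 6 statements merged into one kernel-verified Lean document; each statement's English description precedes it below -/
import Mathlib

section
/- Let g, h ∈ G = GL(α+k∞, ℚ_p). Then there exists N₀ such that for all N, N' ≥ N₀ the elements g·𝔍(Θ_N)·h and g·𝔍(Θ_{N'})·h lie in the same double coset K\G/K; that is, there exist u, u' ∈ O(∞, ℤ_p) with g·𝔍(Θ_{N'})·h = 𝔍(u)·(g·𝔍(Θ_N)·h)·𝔍(u'). (Eventual constancy of the sequence defining the product of double cosets.) -/
open scoped BigOperators

/-- The identity matrix over `ℚ_p`, with an arbitrary index set. -/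
noncomputable def idMat (p : ℕ) [Fact p.Prime] {I : Type*} [DecidableEq I] : I → I → ℚ_[p] :=
  fun i j => if i = j then 1 else 0

/-- Product of two (possibly infinite) matrices over `ℚ_p`; the sum is a `finsum`, which is
well defined for the finitary matrices considered here. -/
noncomputable def matMul (p : ℕ) [Fact p.Prime] {I : Type*} (A B : I → I → ℚ_[p]) : I → I → ℚ_[p] :=
  fun i j => ∑ᶠ l, A i l * B l j

/-- A matrix is *finitary* if it differs from the identity matrix in finitely many entries. -/
def IsFinitary (p : ℕ) [Fact p.Prime] {I : Type*} [DecidableEq I] (A : I → I → ℚ_[p]) : Prop :=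
  {x : I × I | A x.1 x.2 ≠ idMat p x.1 x.2}.Finite

/-- A matrix is invertible if it has a two-sided inverse. -/
def IsInvMat (p : ℕ) [Fact p.Prime] {I : Type*} [DecidableEq I] (A : I → I → ℚ_[p]) : Prop :=
  ∃ B : I → I → ℚ_[p], matMul p A B = idMat p ∧ matMul p B A = idMat p

/-- Membership in `O(∞, ℤ_p)`: an `ℕ × ℕ` matrix with entries in `ℤ_p` (p-adic norm at most 1),
differing from the identity in finitely many entries, with `uᵗ u = 1`. -/
def IsOrth (p : ℕ) [Fact p.Prime] (u : ℕ → ℕ → ℚ_[p]) : Prop :=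
  (∀ i j, ‖u i j‖ ≤ 1) ∧ IsFinitary p u ∧
    ∀ i j, (∑ᶠ l, u l i * u l j) = idMat p i j

/-- The diagonal embedding `𝔍 : O(∞, ℤ_p) → GL(α + k∞, ℚ_p)`: identity on the first `α`
coordinates, and `u` on each of the `k` copies of the `ℕ`-indexed coordinates. -/
noncomputable def Jembed (p : ℕ) [Fact p.Prime] (α k : ℕ) (u : ℕ → ℕ → ℚ_[p]) :
    (Fin α ⊕ Fin k × ℕ) → (Fin α ⊕ Fin k × ℕ) → ℚ_[p] :=
  fun i j =>
    match i, j with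
    | Sum.inl a, Sum.inl b => if a = b then 1 else 0
    | Sum.inr si, Sum.inr tj => if si.1 = tj.1 then u si.2 tj.2 else 0
    | _, _ => 0

/-- The matrix `Θ_N ∈ O(∞, ℤ_p)` exchanging `e_i` and `e_{N+i}` for `i < N` and fixing `e_j`
for `j ≥ 2N` (0-indexed). -/
noncomputable def ThetaMat (p : ℕ) [Fact p.Prime] (N : ℕ) : ℕ → ℕ → ℚ_[p] :=
  fun i j => if i = (if j < N then j + N else if j < 2 * N then j - N else j) then 1 else 0

/-- The function exchanging `a + i` and `b + i` for `i < m` and fixing all other naturals. -/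
def blockSwapFun (a b m j : ℕ) : ℕ :=
  if a ≤ j ∧ j < a + m then j - a + b else if b ≤ j ∧ j < b + m then j - b + a else j

theorem blockSwapFun_involutive {a b m : ℕ} (hab : a + m ≤ b) :
    Function.Involutive (blockSwapFun a b m) := by
  intro j
  unfold blockSwapFun
  split_ifs <;> omega

/-- `blockSwapFun` as a permutation, for disjoint blocks. -/
def blockSwap (a b m : ℕ) (hab : a + m ≤ b) : Equiv.Perm ℕ :=
  (blockSwapFun_involutive hab).toPerm

theorem blockSwap_apply {a b m : ℕ} (hab : a + m ≤ b) (j : ℕ) :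
    blockSwap a b m hab j =
      if a ≤ j ∧ j < a + m then j - a + b else if b ≤ j ∧ j < b + m then j - b + a else j :=
  rfl

/-- A permutation of `ℕ` moving only finitely many points. -/
def FinitelySupported (σ : Equiv.Perm ℕ) : Prop := {j | σ j ≠ j}.Finite

theorem FinitelySupported.mul {σ τ : Equiv.Perm ℕ} (hσ : FinitelySupported σ)
    (hτ : FinitelySupported τ) : FinitelySupported (σ * τ) := by
  refine (Set.Finite.union hσ hτ).subset fun j hj => ?_
  by_contra! hc
  simp only [Set.mem_union, Set.mem_ofPred_eq, not_or, not_not] at hc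
  exact hj (by rw [Equiv.Perm.mul_apply, hc.2, hc.1])

theorem FinitelySupported.inv {σ : Equiv.Perm ℕ} (hσ : FinitelySupported σ) :
    FinitelySupported σ⁻¹ := by
  refine Set.Finite.subset hσ fun j hj hc => hj ?_
  rw [Equiv.Perm.inv_eq_iff_eq, hc]

theorem finitelySupported_blockSwap {a b m : ℕ} (hab : a + m ≤ b) :
    FinitelySupported (blockSwap a b m hab) := by
  refine (Set.finite_Iio (b + m)).subset fun j hj => ?_
  rw [Set.mem_ofPred_eq, blockSwap_apply] at hj
  rw [Set.mem_Iio]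
  split_ifs at hj <;> omega

/-- The matrix of a permutation of `ℕ`. -/
noncomputable def permMat (p : ℕ) [Fact p.Prime] (σ : Equiv.Perm ℕ) : ℕ → ℕ → ℚ_[p] :=
  fun i j => if i = σ j then 1 else 0

theorem isOrth_permMat (p : ℕ) [Fact p.Prime] {σ : Equiv.Perm ℕ} (hσ : FinitelySupported σ) :
    IsOrth p (permMat p σ) := by
  refine ⟨fun i j => ?_, ?_, fun i j => ?_⟩
  · unfold permMat
    split_ifs <;> simp
  · refine ((Set.Finite.image (fun j => (σ j, j)) hσ).union
      (Set.Finite.image (fun j => (j, j)) hσ)).subset ?_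
    rintro ⟨i, j⟩ hij
    have hj : σ j ≠ j := fun hc => hij (by simp [permMat, idMat, hc])
    by_cases h₁ : i = σ j
    · exact Or.inl ⟨j, hj, by rw [h₁]⟩
    · by_cases h₂ : i = j
      · exact Or.inr ⟨j, hj, by rw [h₂]⟩
      · exact absurd (by simp [permMat, idMat, h₁, h₂]) hij
  · rw [finsum_eq_single _ (σ i) fun l hl => by simp [permMat, hl]]
    simp [permMat, idMat]

theorem thetaMat_eq_permMat (p : ℕ) [Fact p.Prime] (N : ℕ) :
    ThetaMat p N = permMat p (blockSwap 0 N N (by omega)) := by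
  funext i j
  unfold ThetaMat permMat
  congr 2
  rw [blockSwap_apply]
  split_ifs <;> omega

/-- The action of a permutation of `ℕ` on the index set of `GL(α + k∞)`. -/
def indexPerm (α k : ℕ) (σ : Equiv.Perm ℕ) : Equiv.Perm (Fin α ⊕ Fin k × ℕ) :=
  Equiv.sumCongr (Equiv.refl _) (Equiv.prodCongr (Equiv.refl _) σ)

@[simp] theorem indexPerm_inl (α k : ℕ) (σ : Equiv.Perm ℕ) (a : Fin α) :
    indexPerm α k σ (Sum.inl a) = Sum.inl a := rfl

@[simp] theorem indexPerm_inr (α k : ℕ) (σ : Equiv.Perm ℕ) (x : Fin k × ℕ) :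
    indexPerm α k σ (Sum.inr x) = Sum.inr (x.1, σ x.2) := rfl

theorem indexPerm_mul (α k : ℕ) (σ τ : Equiv.Perm ℕ) :
    indexPerm α k (σ * τ) = indexPerm α k σ * indexPerm α k τ := by
  ext x
  rcases x with a | x <;> rfl

theorem jembed_permMat (p : ℕ) [Fact p.Prime] (α k : ℕ) (σ : Equiv.Perm ℕ)
    (i j : Fin α ⊕ Fin k × ℕ) :
    Jembed p α k (permMat p σ) i j = if i = indexPerm α k σ j then 1 else 0 := by
  rcases i with a | ⟨s, m⟩ <;> rcases j with b | ⟨t, n⟩ <;>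
    simp [Jembed, permMat, ite_and]

theorem matMul_jembed_permMat (p : ℕ) [Fact p.Prime] (α k : ℕ) (σ : Equiv.Perm ℕ)
    (A : (Fin α ⊕ Fin k × ℕ) → (Fin α ⊕ Fin k × ℕ) → ℚ_[p]) (i j : Fin α ⊕ Fin k × ℕ) :
    matMul p A (Jembed p α k (permMat p σ)) i j = A i (indexPerm α k σ j) := by
  unfold matMul
  simp only [jembed_permMat]
  rw [finsum_eq_single _ (indexPerm α k σ j) fun l hl => by simp [hl]]
  simp

theorem jembed_permMat_matMul (p : ℕ) [Fact p.Prime] (α k : ℕ) (σ : Equiv.Perm ℕ)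
    (A : (Fin α ⊕ Fin k × ℕ) → (Fin α ⊕ Fin k × ℕ) → ℚ_[p]) (i j : Fin α ⊕ Fin k × ℕ) :
    matMul p (Jembed p α k (permMat p σ)) A (indexPerm α k σ i) j = A i j := by
  unfold matMul
  simp only [jembed_permMat]
  rw [finsum_eq_single _ i fun l hl => by simp [hl.symm]]
  simp

/-- A finitary matrix is invariant under all permutations fixing a long enough initial segment. -/
theorem IsFinitary.exists_indexPerm_invariant {p : ℕ} [Fact p.Prime] {α k : ℕ}
    {A : (Fin α ⊕ Fin k × ℕ) → (Fin α ⊕ Fin k × ℕ) → ℚ_[p]} (hA : IsFinitary p A) :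
    ∃ M : ℕ, ∀ σ : Equiv.Perm ℕ, (∀ j < M, σ j = j) →
      ∀ x y, A (indexPerm α k σ x) (indexPerm α k σ y) = A x y := by
  let c : Fin α ⊕ Fin k × ℕ → ℕ := Sum.elim (fun _ => 0) Prod.snd
  obtain ⟨M, hM⟩ := (hA.image fun x => max (c x.1) (c x.2)).bddAbove
  refine ⟨M + 1, fun σ hσ x y => ?_⟩
  have hfix : ∀ x, c x ≤ M → indexPerm α k σ x = x := by
    rintro (a | ⟨s, n⟩) hx
    · rfl
    · simp [hσ n (Nat.lt_succ_of_le hx)]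
  have hbd : ∀ x y, A x y ≠ idMat p x y → c x ≤ M ∧ c y ≤ M := fun x y hxy =>
    max_le_iff.1 (hM ⟨(x, y), hxy, rfl⟩)
  by_cases h₁ : A x y = idMat p x y
  · by_cases h₂ : A (indexPerm α k σ x) (indexPerm α k σ y) =
        idMat p (indexPerm α k σ x) (indexPerm α k σ y)
    · rw [h₁, h₂]
      simp [idMat]
    · obtain ⟨hx, hy⟩ := hbd _ _ h₂
      rw [(indexPerm α k σ).injective (hfix _ hx), (indexPerm α k σ).injective (hfix _ hy)]
  · obtain ⟨hx, hy⟩ := hbd _ _ h₁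
    rw [hfix x hx, hfix y hy]

/-- For `N, N' ≥ M`, the permutations underlying `Θ_N` and `Θ_{N'}` agree up to left and right
multiplication by finitely supported permutations fixing `0, …, M - 1`. -/
theorem exists_perm_mul_blockSwap {M N N' : ℕ} (hN : M ≤ N) (hN' : M ≤ N') :
    ∃ σ τ : Equiv.Perm ℕ, FinitelySupported σ ∧ FinitelySupported τ ∧
      (∀ j < M, σ j = j) ∧ (∀ j < M, τ j = j) ∧
      σ * blockSwap 0 N N (by omega) * τ = blockSwap 0 N' N' (by omega) := by
  let L := N + N' + M
  let τ : Equiv.Perm ℕ :=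
    blockSwap N L M (by omega) * blockSwap N' L M (by omega)
  have hτ : FinitelySupported τ :=
    (finitelySupported_blockSwap _).mul (finitelySupported_blockSwap _)
  have hτN : ∀ j < M, τ (N' + j) = N + j := by
    intro j hj
    have h₁ : blockSwap N' L M (by omega) (N' + j) = L + j := by
      rw [blockSwap_apply]
      split_ifs <;> omega
    change blockSwap N L M (by omega) (blockSwap N' L M (by omega) (N' + j)) = N + j
    rw [h₁, blockSwap_apply]
    split_ifs <;> omega
  refine ⟨blockSwap 0 N' N' (by omega) * τ⁻¹ * (blockSwap 0 N N (by omega))⁻¹, τ,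
    ((finitelySupported_blockSwap _).mul hτ.inv).mul (finitelySupported_blockSwap _).inv, hτ,
    fun j hj => ?_, fun j hj => ?_, by group⟩
  · have h₁ : (blockSwap 0 N N (by omega))⁻¹ j = N + j := by
      rw [Equiv.Perm.inv_eq_iff_eq, blockSwap_apply]
      split_ifs <;> omega
    have h₂ : τ⁻¹ (N + j) = N' + j := by
      rw [Equiv.Perm.inv_eq_iff_eq, hτN j hj]
    rw [Equiv.Perm.mul_apply, Equiv.Perm.mul_apply, h₁, h₂, blockSwap_apply]
    split_ifs <;> omega
  · have h₁ : blockSwap N' L M (by omega) j = j := by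
      rw [blockSwap_apply]
      split_ifs <;> omega
    change blockSwap N L M (by omega) (blockSwap N' L M (by omega) j) = j
    rw [h₁, blockSwap_apply]
    split_ifs <;> omega

/-- **Eventual constancy of the sequence defining the product of double cosets.**
For `g, h ∈ G = GL(α + k∞, ℚ_p)`, there exists `N₀` such that for all `N, N' ≥ N₀` the
elements `g·𝔍(Θ_N)·h` and `g·𝔍(Θ_{N'})·h` lie in the same double coset `K\G/K`. -/
theorem double_coset_product_eventually_constant (p : ℕ) [Fact p.Prime] (α k : ℕ)
    (hk : 1 ≤ k) (g h : (Fin α ⊕ Fin k × ℕ) → (Fin α ⊕ Fin k × ℕ) → ℚ_[p])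
    (hgfin : IsFinitary p g) (hginv : IsInvMat p g)
    (hhfin : IsFinitary p h) (hhinv : IsInvMat p h) :
    ∃ N₀ : ℕ, ∀ N N' : ℕ, N₀ ≤ N → N₀ ≤ N' →
      ∃ u u' : ℕ → ℕ → ℚ_[p], IsOrth p u ∧ IsOrth p u' ∧
        matMul p (matMul p g (Jembed p α k (ThetaMat p N'))) h =
          matMul p (matMul p (Jembed p α k u)
            (matMul p (matMul p g (Jembed p α k (ThetaMat p N))) h)) (Jembed p α k u') := by
  obtain ⟨M₁, hM₁⟩ := hgfin.exists_indexPerm_invariant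
  obtain ⟨M₂, hM₂⟩ := hhfin.exists_indexPerm_invariant
  refine ⟨max M₁ M₂, fun N N' hN hN' => ?_⟩
  obtain ⟨σ, τ, hσ, hτ, hσM, hτM, hmul⟩ := exists_perm_mul_blockSwap hN hN'
  refine ⟨permMat p σ, permMat p τ, isOrth_permMat p hσ, isOrth_permMat p hτ, ?_⟩
  have hg := hM₁ σ fun j hj => hσM j (lt_of_lt_of_le hj (le_max_left _ _))
  have hh := hM₂ τ fun j hj => hτM j (lt_of_lt_of_le hj (le_max_right _ _))
  funext x j
  obtain ⟨i, rfl⟩ := (indexPerm α k σ).surjective x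
  rw [matMul_jembed_permMat, jembed_permMat_matMul, thetaMat_eq_permMat, thetaMat_eq_permMat,
    ← hmul]
  change ∑ᶠ l, _ = ∑ᶠ l, _
  symm
  rw [← finsum_comp_equiv (indexPerm α k τ)]
  refine finsum_congr fun l => ?_
  rw [matMul_jembed_permMat, matMul_jembed_permMat, hh, indexPerm_mul, indexPerm_mul,
    Equiv.Perm.mul_apply, Equiv.Perm.mul_apply, hg]
end

section
/- Nazarov's theorem (composition of self-dual relations): let V = ℚ_p^{2n}, W = ℚ_p^{2m}, Y = ℚ_p^{2l} carry the standard symplectic forms. If P ⊆ V⊕W is a self-dual ℤ_p-submodule with respect to the form B^⊖_{V,W} and Q ⊆ W⊕Y is a self-dual ℤ_p-submodule with respect to B^⊖_{W,Y}, then the composition QP ⊆ V⊕Y is a self-dual ℤ_p-submodule with respect to B^⊖_{V,Y}. -/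
open scoped BigOperators

/-- The symplectic coordinate space `ℚ_p^{2n}`, written as pairs `(x⁺, x⁻)`. -/
abbrev SpV (p : ℕ) [Fact p.Prime] (n : ℕ) := (Fin n → ℚ_[p]) × (Fin n → ℚ_[p])

/-- The standard nondegenerate skew-symmetric bilinear form on `ℚ_p^{2n}`:
`B(x, y) = Σ_i (x_i y_{n+i} − x_{n+i} y_i)`. -/
noncomputable def Bform (p : ℕ) [Fact p.Prime] (n : ℕ) (x y : SpV p n) : ℚ_[p] :=
  ∑ i, (x.1 i * y.2 i - x.2 i * y.1 i)

/-- The difference form `B^⊖((v,w),(v',w')) = B₁(v,v') − B₂(w,w')` on a direct sum. -/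
noncomputable def BminusGen (p : ℕ) [Fact p.Prime] {X Y : Type*}
    (B1 : X → X → ℚ_[p]) (B2 : Y → Y → ℚ_[p]) (a b : X × Y) : ℚ_[p] :=
  B1 a.1 b.1 - B2 a.2 b.2

/-- The dual module `P^⊥⊥ = {w : B(v,w) ∈ ℤ_p for all v ∈ P}` of a set `P` with respect to a
bilinear form `B` (membership in `ℤ_p` expressed as `‖·‖ ≤ 1`). -/
def dualMod (p : ℕ) [Fact p.Prime] {X : Type*} (B : X → X → ℚ_[p]) (P : Set X) : Set X :=
  {w | ∀ v ∈ P, ‖B v w‖ ≤ 1}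

/-- A set is *self-dual* with respect to `B` if it coincides with its dual module. -/
def IsSelfDual (p : ℕ) [Fact p.Prime] {X : Type*} (B : X → X → ℚ_[p]) (P : Set X) : Prop :=
  dualMod p B P = P

/-- A `ℤ_p`-submodule of a `ℚ_p`-vector space: a set containing `0`, closed under addition
and under multiplication by p-adic integers (scalars of norm at most 1). -/
def IsZpSubmodule (p : ℕ) [Fact p.Prime] {X : Type*} [AddCommGroup X] [Module ℚ_[p] X]
    (P : Set X) : Prop :=
  (0 : X) ∈ P ∧ (∀ x ∈ P, ∀ y ∈ P, x + y ∈ P) ∧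
    ∀ c : ℚ_[p], ‖c‖ ≤ 1 → ∀ x ∈ P, c • x ∈ P

/-- Composition of relations: `QP = {(v, y) : ∃ w, (v, w) ∈ P ∧ (w, y) ∈ Q}`. -/
def relComp {X Y Z : Type*} (Q : Set (Y × Z)) (P : Set (X × Y)) : Set (X × Z) :=
  {vz | ∃ w : Y, (vz.1, w) ∈ P ∧ (w, vz.2) ∈ Q}

/-- One-step extension: a functional `g` that is integral on `M ∩ ker h` can be corrected by a
multiple of `h` so as to be integral on all of `M`. -/
theorem exists_norm_add_mul_le_one (p : ℕ) [Fact p.Prime] {X : Type*} [AddCommGroup X]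
    [Module ℚ_[p] X] {M : Set X} (hM : IsZpSubmodule p M) (g h : X →ₗ[ℚ_[p]] ℚ_[p])
    (hgh : ∀ z ∈ M, h z = 0 → ‖g z‖ ≤ 1) :
    ∃ s : ℚ_[p], ∀ z ∈ M, ‖g z + s * h z‖ ≤ 1 := by
  let ι := {z : X // z ∈ M ∧ h z ≠ 0}
  let S : ι → Set ℚ_[p] := fun z => {s | ‖g z + s * h z‖ ≤ 1}
  have hS : ∀ z : ι, S z = Metric.closedBall (-(g z / h z)) (‖h z‖⁻¹) := by
    intro z
    have hz : h z ≠ 0 := z.2.2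
    ext s
    have hfac : g z + s * h z = (s - -(g z / h z)) * h z := by field_simp; ring
    rw [Metric.mem_closedBall, dist_eq_norm, Set.mem_ofPred_eq, hfac, norm_mul,
      ← le_div_iff₀ (norm_pos_iff.2 hz), one_div]
  have hsub : ∀ z z' : ι, ‖h z'‖ ≤ ‖h z‖ → S z ⊆ S z' := by
    intro z z' hle s hs
    have hz : h z ≠ 0 := z.2.2
    have ha : ‖h z' / h z‖ ≤ 1 := by
      rw [norm_div]
      exact div_le_one_of_le₀ hle (norm_nonneg _)
    have hmem : (z' : X) + (-(h z' / h z)) • (z : X) ∈ M :=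
      hM.2.1 _ z'.2.1 _ (hM.2.2 _ (by rwa [norm_neg]) _ z.2.1)
    have hint := hgh _ hmem (by simp [hz])
    have hsplit : g z' + s * h z' = g ((z' : X) + (-(h z' / h z)) • (z : X)) +
        (h z' / h z) * (g z + s * h z) := by
      simp only [map_add, map_smul, smul_eq_mul]
      field_simp
      ring
    change ‖g z' + s * h z'‖ ≤ 1
    rw [hsplit]
    refine (Padic.nonarchimedean _ _).trans (max_le hint ?_)
    rw [norm_mul]
    exact mul_le_one₀ ha (norm_nonneg _) hs
  obtain hι | hι := isEmpty_or_nonempty ι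
  · refine ⟨0, fun z hz => ?_⟩
    rw [zero_mul, add_zero]
    exact hgh z hz (by_contra fun hne => hι.false ⟨z, hz, hne⟩)
  · have hdir : Directed (· ⊇ ·) S := fun z z' => by
      obtain hle | hle := le_total ‖h z‖ ‖h z'‖
      · exact ⟨z', hsub z' z hle, subset_rfl⟩
      · exact ⟨z, subset_rfl, hsub z z' hle⟩
    obtain ⟨s, hs⟩ := IsCompact.nonempty_iInter_of_directed_nonempty_isCompact_isClosed S hdir
      (fun z => by rw [hS]; exact Metric.nonempty_closedBall.2 (by positivity))
      (fun z => by rw [hS]; exact isCompact_closedBall _ _)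
      (fun z => by rw [hS]; exact Metric.isClosed_closedBall)
    refine ⟨s, fun z hz => ?_⟩
    by_cases hne : h z = 0
    · rw [hne, mul_zero, add_zero]
      exact hgh z hz hne
    · exact Set.mem_iInter.1 hs ⟨z, hz, hne⟩

/-- A vector outside a `ℤ_p`-submodule of a finite-dimensional `ℚ_p`-space is separated from it
by a linear functional. -/
theorem IsZpSubmodule.exists_separating_functional (p : ℕ) [Fact p.Prime] {X : Type*}
    [AddCommGroup X] [Module ℚ_[p] X] [Module.Finite ℚ_[p] X] {L : Set X}
    (hL : IsZpSubmodule p L) {x : X} (hx : x ∉ L) :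
    ∃ f : X →ₗ[ℚ_[p]] ℚ_[p], (∀ z ∈ L, ‖f z‖ ≤ 1) ∧ 1 < ‖f x‖ := by
  classical
  have hx0 : x ≠ 0 := fun h => hx (h ▸ hL.1)
  have hp1 : (1 : ℝ) < p := by exact_mod_cast (Fact.out : p.Prime).one_lt
  have key : ∀ T : Finset X, ∃ f : X →ₗ[ℚ_[p]] ℚ_[p], f x = (p : ℚ_[p])⁻¹ ∧
      ∀ z ∈ L, z ∈ Submodule.span ℚ_[p] {x} ⊔ Submodule.span ℚ_[p] (T : Set X) →
        ‖f z‖ ≤ 1 := by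
    intro T
    induction T using Finset.induction_on with
    | empty =>
      obtain ⟨f, hf⟩ := Module.Projective.exists_dual_ne_zero ℚ_[p] hx0
      refine ⟨((p : ℚ_[p])⁻¹ * (f x)⁻¹) • f, by simp [hf], fun z hz hzx => ?_⟩
      rw [Finset.coe_empty, Submodule.span_empty, sup_bot_eq] at hzx
      obtain ⟨c, rfl⟩ := Submodule.mem_span_singleton.1 hzx
      have hc : ‖c‖ < 1 := by
        by_contra! hc
        have hc0 : c ≠ 0 := norm_pos_iff.1 (one_pos.trans_le hc)
        apply hx
        have := hL.2.2 c⁻¹ (by rw [norm_inv]; exact inv_le_one_of_one_le₀ hc) _ hz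
        rwa [inv_smul_smul₀ hc0] at this
      have hc' : ‖c‖ ≤ (p : ℝ)⁻¹ := by
        have := (Padic.norm_le_pow_iff_norm_lt_pow_add_one c (-1)).2 (by simpa using hc)
        simpa using this
      have hval : (((p : ℚ_[p])⁻¹ * (f x)⁻¹) • f) (c • x) = (p : ℚ_[p])⁻¹ * c := by
        simp only [LinearMap.smul_apply, map_smul, smul_eq_mul]
        field_simp
      rw [hval, norm_mul, norm_inv, Padic.norm_p, inv_inv]
      calc (p : ℝ) * ‖c‖ ≤ p * (p : ℝ)⁻¹ := by gcongr
        _ = 1 := mul_inv_cancel₀ (by positivity)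
    | insert a T _ ih =>
      obtain ⟨g, hgx, hg⟩ := ih
      set U := Submodule.span ℚ_[p] {x} ⊔ Submodule.span ℚ_[p] (T : Set X) with hU
      have hins : Submodule.span ℚ_[p] {x} ⊔ Submodule.span ℚ_[p] (↑(insert a T) : Set X) =
          U ⊔ Submodule.span ℚ_[p] {a} := by
        rw [Finset.coe_insert, Submodule.span_insert, hU, sup_assoc, sup_comm (Submodule.span _ {a})]
      rw [hins]
      by_cases ha : a ∈ U
      · rw [sup_eq_left.2 ((Submodule.span_singleton_le_iff_mem _ _).2 ha)]
        exact ⟨g, hgx, hg⟩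
      · obtain ⟨h, hha, hhU⟩ := Submodule.exists_le_ker_of_notMem ha
        have hM : IsZpSubmodule p (L ∩ (U ⊔ Submodule.span ℚ_[p] {a} : Submodule ℚ_[p] X)) :=
          ⟨⟨hL.1, Submodule.zero_mem _⟩,
            fun y hy z hz => ⟨hL.2.1 y hy.1 z hz.1, Submodule.add_mem _ hy.2 hz.2⟩,
            fun c hc y hy => ⟨hL.2.2 c hc y hy.1, Submodule.smul_mem _ c hy.2⟩⟩
        obtain ⟨s, hs⟩ := exists_norm_add_mul_le_one p hM g h (by
          rintro z ⟨hzL, hz⟩ hhz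
          obtain ⟨u, hu, w, hw, rfl⟩ := Submodule.mem_sup.1 hz
          obtain ⟨c, rfl⟩ := Submodule.mem_span_singleton.1 hw
          have hu0 : h u = 0 := hhU hu
          have hc : c = 0 := by simpa [hu0, hha] using hhz
          subst hc
          exact hg _ hzL (by simpa using hu))
        have hhx : h x = 0 :=
          hhU (Submodule.mem_sup_left (Submodule.mem_span_singleton_self x))
        exact ⟨g + s • h, by simp [hhx, hgx], fun z hz hz' => hs z ⟨hz, hz'⟩⟩
  obtain ⟨T, hT⟩ := Module.Finite.fg_top (R := ℚ_[p]) (M := X)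
  obtain ⟨f, hfx, hf⟩ := key T
  refine ⟨f, fun z hz => hf z hz (by simp [hT]), ?_⟩
  rwa [hfx, norm_inv, Padic.norm_p, inv_inv]

theorem Bform_swap (p : ℕ) [Fact p.Prime] (n : ℕ) (x y : SpV p n) :
    Bform p n x y = -Bform p n y x := by
  simp only [Bform, ← Finset.sum_neg_distrib]
  exact Finset.sum_congr rfl fun i _ => by ring

/-- The symplectic form represents every linear functional. -/
theorem exists_Bform_eq (p : ℕ) [Fact p.Prime] (n : ℕ) (f : SpV p n →ₗ[ℚ_[p]] ℚ_[p]) :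
    ∃ a : SpV p n, ∀ x, f x = Bform p n x a := by
  classical
  refine ⟨(fun i => -f (0, Pi.single i 1), fun i => f (Pi.single i 1, 0)), fun x => ?_⟩
  have h1 := (f ∘ₗ LinearMap.inl ℚ_[p] _ _).pi_apply_eq_sum_univ x.1
  have h2 := (f ∘ₗ LinearMap.inr ℚ_[p] _ _).pi_apply_eq_sum_univ x.2
  have hx : f x = f (x.1, 0) + f (0, x.2) := by rw [← map_add]; simp
  simp only [LinearMap.comp_apply, LinearMap.inl_apply, LinearMap.inr_apply, smul_eq_mul] at h1 h2
  rw [hx, h1, h2, Bform, ← Finset.sum_add_distrib]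
  refine Finset.sum_congr rfl fun i _ => ?_
  have hi : (fun j => if i = j then (1 : ℚ_[p]) else 0) = Pi.single i 1 := by
    ext j
    simp [Pi.single_apply, eq_comm]
  rw [hi]
  ring

/-- **Nazarov's theorem (composition of self-dual relations).** If `P ⊆ V ⊕ W` and
`Q ⊆ W ⊕ Y` are self-dual `ℤ_p`-submodules with respect to `B^⊖`, then the composition
`QP ⊆ V ⊕ Y` is a self-dual `ℤ_p`-submodule with respect to `B^⊖`. -/
theorem nazarov_selfdual_composition (p : ℕ) [Fact p.Prime] (n m l : ℕ)
    (hn : 1 ≤ n) (hm : 1 ≤ m) (hl : 1 ≤ l)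
    (P : Set (SpV p n × SpV p m)) (Q : Set (SpV p m × SpV p l))
    (hPmod : IsZpSubmodule p P) (hQmod : IsZpSubmodule p Q)
    (hP : IsSelfDual p (BminusGen p (Bform p n) (Bform p m)) P)
    (hQ : IsSelfDual p (BminusGen p (Bform p m) (Bform p l)) Q) :
    IsSelfDual p (BminusGen p (Bform p n) (Bform p l)) (relComp Q P) := by
  apply Set.Subset.antisymm
  · rintro ⟨v, y⟩ hvy
    let N : Set (SpV p n × SpV p m × SpV p l) :=
      {t | ∃ w₁ w₂, (t.1, w₁) ∈ P ∧ (w₂, t.2.2) ∈ Q ∧ t.2.1 = w₁ - w₂}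
    have hN : IsZpSubmodule p N := by
      refine ⟨⟨0, 0, hPmod.1, hQmod.1, by simp⟩, ?_, ?_⟩
      · rintro s ⟨w₁, w₂, h₁, h₂, h⟩ t ⟨w₁', w₂', h₁', h₂', h'⟩
        refine ⟨w₁ + w₁', w₂ + w₂', hPmod.2.1 _ h₁ _ h₁', hQmod.2.1 _ h₂ _ h₂', ?_⟩
        rw [Prod.snd_add, Prod.fst_add, h, h']
        abel
      · rintro c hc t ⟨w₁, w₂, h₁, h₂, h⟩
        refine ⟨c • w₁, c • w₂, hPmod.2.2 c hc _ h₁, hQmod.2.2 c hc _ h₂, ?_⟩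
        rw [Prod.smul_snd, Prod.smul_fst, h, smul_sub]
    suffices hmem : (v, (0 : SpV p m), y) ∈ N by
      obtain ⟨w₁, w₂, h₁, h₂, h⟩ := hmem
      obtain rfl : w₁ = w₂ := sub_eq_zero.1 h.symm
      exact ⟨w₁, h₁, h₂⟩
    by_contra hnot
    obtain ⟨f, hfN, hf⟩ := hN.exists_separating_functional p hnot
    obtain ⟨a, ha⟩ := exists_Bform_eq p n (f ∘ₗ LinearMap.inl _ _ _)
    obtain ⟨b, hb⟩ := exists_Bform_eq p m (-(f ∘ₗ LinearMap.inr _ _ _ ∘ₗ LinearMap.inl _ _ _))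
    obtain ⟨c, hc⟩ := exists_Bform_eq p l (-(f ∘ₗ LinearMap.inr _ _ _ ∘ₗ LinearMap.inr _ _ _))
    have hrep : ∀ v w y, f (v, w, y) = Bform p n v a - Bform p m w b - Bform p l y c := by
      intro v w y
      rw [← ha, ← hb, ← hc]
      simp only [LinearMap.neg_apply, LinearMap.comp_apply, LinearMap.inl_apply,
        LinearMap.inr_apply, sub_neg_eq_add, ← map_add]
      simp
    have hB0 : ∀ (k : ℕ) (z : SpV p k), Bform p k 0 z = 0 := fun k z => by simp [Bform]
    have hab : (a, b) ∈ P := by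
      rw [← hP]
      rintro ⟨v', w'⟩ hvw
      have := hfN (v', w', 0) ⟨w', 0, hvw, hQmod.1, by simp⟩
      rwa [hrep, hB0, sub_zero] at this
    have hbc : (b, c) ∈ Q := by
      rw [← hQ]
      rintro ⟨w', y'⟩ hwy
      have := hfN (0, -w', y') ⟨0, w', hPmod.1, hwy, by simp⟩
      rw [hrep, hB0, zero_sub] at this
      have hneg : Bform p m (-w') b = -Bform p m w' b := by
        simp only [Bform, ← Finset.sum_neg_distrib]
        exact Finset.sum_congr rfl fun i _ => by simp; ring
      rwa [hneg, neg_neg] at this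
    have hle : ‖Bform p n a v - Bform p l c y‖ ≤ 1 := hvy (a, c) ⟨b, hab, hbc⟩
    rw [hrep, hB0, sub_zero, Bform_swap p n, Bform_swap p l, ← neg_sub', norm_neg] at hf
    exact hf.not_ge hle
  · rintro ⟨v, y⟩ ⟨w, hvw, hwy⟩ ⟨v', y'⟩ ⟨w', hvw', hwy'⟩
    have h₁ := hP.ge hvw _ hvw'
    have h₂ := hQ.ge hwy _ hwy'
    simp only [BminusGen] at h₁ h₂ ⊢
    rw [← sub_add_sub_cancel _ (Bform p m w' w)]
    exact (Padic.nonarchimedean _ _).trans (max_le h₁ h₂)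
end

section
/- Nazarov's theorem (compactness and lattices): let V = ℚ_p^{2n}, W = ℚ_p^{2m}, Y = ℚ_p^{2l} carry the standard symplectic forms, let P ⊆ V⊕W and Q ⊆ W⊕Y be self-dual ℤ_p-submodules with respect to B^⊖_{V,W} and B^⊖_{W,Y} respectively. (a) If ker P, indef P, ker Q, indef Q are all compact, then ker(QP) and indef(QP) are compact. (b) If moreover P and Q are lattices (compact submodules whose ℚ_p-spans are V⊕W and W⊕Y respectively), then QP is a lattice in V⊕Y. -/
open scoped BigOperators

/-- The kernel of a relation `P : V ⇉ W`: `ker P = {v : (v, 0) ∈ P}`. -/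
def kerRel {X Y : Type*} [Zero Y] (P : Set (X × Y)) : Set X :=
  {v | (v, 0) ∈ P}

/-- The indefiniteness of a relation `P : V ⇉ W`: `indef P = {w : (0, w) ∈ P}`. -/
def indefRel {X Y : Type*} [Zero X] (P : Set (X × Y)) : Set Y :=
  {w | (0, w) ∈ P}

/-- A lattice in a finite-dimensional `ℚ_p`-vector space: a compact `ℤ_p`-submodule whose
`ℚ_p`-span is the whole space. -/
def IsLatticeSet (p : ℕ) [Fact p.Prime] {X : Type*} [AddCommGroup X] [Module ℚ_[p] X]
    [TopologicalSpace X] (P : Set X) : Prop :=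
  IsZpSubmodule p P ∧ IsCompact P ∧ Submodule.span ℚ_[p] P = ⊤

section ZpSubmodule

variable {p : ℕ} [Fact p.Prime]

theorem eq_zero_of_smul_mem_isCompact {E : Type*} [NormedAddCommGroup E] [NormedSpace ℚ_[p] E]
    {K : Set E} (hK : IsCompact K) {u : E} (hu : ∀ c : ℚ_[p], c • u ∈ K) : u = 0 := by
  by_contra hne
  have hpos : 0 < ‖u‖ := norm_pos_iff.2 hne
  obtain ⟨C, hC⟩ := hK.isBounded.exists_norm_le
  obtain ⟨c, hc⟩ := NormedField.exists_lt_norm ℚ_[p] (C / ‖u‖)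
  have hle := hC _ (hu c)
  rw [norm_smul] at hle
  rw [div_lt_iff₀ hpos] at hc
  linarith

/-- A closed `ℤ_p`-submodule that contains no line is compact. -/
theorem IsZpSubmodule.isCompact_of_forall_line {E : Type*} [NormedAddCommGroup E]
    [NormedSpace ℚ_[p] E] [ProperSpace E] {S : Set E} (hS : IsZpSubmodule p S)
    (hclosed : IsClosed S) (hline : ∀ u : E, (∀ c : ℚ_[p], c • u ∈ S) → u = 0) :
    IsCompact S := by
  refine Metric.isCompact_of_isClosed_isBounded hclosed ?_
  by_contra hunb
  have hlarge : ∀ k : ℕ, ∃ x ∈ S, (k : ℝ) < ‖x‖ := by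
    intro k
    by_contra! hk
    exact hunb (isBounded_iff_forall_norm_le.2 ⟨k, hk⟩)
  choose x hxS hx using hlarge
  obtain ⟨a, ha⟩ := NormedField.exists_one_lt_norm ℚ_[p]
  have hxpos : ∀ k, 0 < ‖x k‖ := fun k => (Nat.cast_nonneg k).trans_lt (hx k)
  choose d _ hdlt hdge _ using fun k =>
    rescale_to_shell (𝕜 := ℚ_[p]) ha one_pos (norm_pos_iff.1 (hxpos k))
  obtain ⟨u, _, φ, hφ, hlim⟩ := (isCompact_closedBall (0 : E) 1).tendsto_subseq
    (x := fun k => d k • x k) fun k => mem_closedBall_zero_iff.2 (hdlt k).le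
  have hunorm : 1 / ‖a‖ ≤ ‖u‖ :=
    ge_of_tendsto' hlim.norm fun k => hdge (φ k)
  have hu : u ≠ 0 := norm_pos_iff.1 ((by positivity : 0 < 1 / ‖a‖).trans_le hunorm)
  refine hu (hline u fun c => hclosed.mem_of_tendsto (hlim.const_smul c) ?_)
  obtain ⟨N, hN⟩ := exists_nat_ge ‖c‖
  filter_upwards [Filter.eventually_ge_atTop N] with k hk
  have hck : ‖c‖ ≤ ‖x (φ k)‖ :=
    hN.trans ((Nat.cast_le.2 (hk.trans (hφ.id_le k))).trans (hx (φ k)).le)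
  change c • d (φ k) • x (φ k) ∈ S
  rw [smul_smul]
  refine hS.2.2 _ ?_ _ (hxS _)
  have hd := hdlt (φ k)
  rw [norm_smul] at hd
  rw [norm_mul, mul_comm]
  exact (mul_le_mul_of_nonneg_left hck (norm_nonneg _)).trans hd.le

/-- A closed `ℤ_p`-submodule `S` meets the preimage of a compact `ℤ_p`-submodule in a compact set
as soon as the linear map has compact kernel on `S`. -/
theorem IsZpSubmodule.isCompact_inter_preimage {E F : Type*} [NormedAddCommGroup E]
    [NormedSpace ℚ_[p] E] [ProperSpace E] [NormedAddCommGroup F] [NormedSpace ℚ_[p] F]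
    {S : Set E} {K : Set F} (hS : IsZpSubmodule p S) (hclosed : IsClosed S) (f : E →L[ℚ_[p]] F)
    (hK : IsZpSubmodule p K) (hKc : IsCompact K) (hker : IsCompact (S ∩ f ⁻¹' {0})) :
    IsCompact (S ∩ f ⁻¹' K) := by
  refine IsZpSubmodule.isCompact_of_forall_line (p := p) ⟨?_, ?_, ?_⟩
    (hclosed.inter (hKc.isClosed.preimage f.continuous)) fun u hu => ?_
  · exact ⟨hS.1, by simpa using hK.1⟩
  · rintro x ⟨hx, hfx⟩ y ⟨hy, hfy⟩
    exact ⟨hS.2.1 x hx y hy, by simpa using hK.2.1 _ hfx _ hfy⟩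
  · rintro c hc x ⟨hx, hfx⟩
    exact ⟨hS.2.2 c hc x hx, by simpa using hK.2.2 c hc _ hfx⟩
  · have hfu : f u = 0 := eq_zero_of_smul_mem_isCompact hKc fun c => by simpa using (hu c).2
    exact eq_zero_of_smul_mem_isCompact hker fun c => ⟨(hu c).1, by simp [hfu]⟩

theorem IsSelfDual.isClosed {X : Type*} [TopologicalSpace X] {B : X → X → ℚ_[p]} {P : Set X}
    (hP : IsSelfDual p B P) (hB : ∀ v, Continuous (B v)) : IsClosed P := by
  rw [← hP]
  simp only [dualMod, Set.ofPred_forall]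
  exact isClosed_biInter fun v _ => isClosed_le (hB v).norm continuous_const

theorem continuous_BminusGen_Bform (n m : ℕ) (v : SpV p n × SpV p m) :
    Continuous (BminusGen p (Bform p n) (Bform p m) v) := by
  unfold BminusGen Bform
  fun_prop

section Relations

variable {X Y Z : Type*} [AddCommGroup X] [Module ℚ_[p] X] [AddCommGroup Y] [Module ℚ_[p] Y]
  [AddCommGroup Z] [Module ℚ_[p] Z]

theorem IsZpSubmodule.kerRel {P : Set (X × Y)} (hP : IsZpSubmodule p P) :
    IsZpSubmodule p (kerRel P) :=
  ⟨hP.1, fun x hx y hy => by simpa [_root_.kerRel] using hP.2.1 _ hx _ hy,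
    fun c hc x hx => by simpa [_root_.kerRel] using hP.2.2 c hc _ hx⟩

theorem IsZpSubmodule.indefRel {P : Set (X × Y)} (hP : IsZpSubmodule p P) :
    IsZpSubmodule p (indefRel P) :=
  ⟨hP.1, fun x hx y hy => by simpa [_root_.indefRel] using hP.2.1 _ hx _ hy,
    fun c hc x hx => by simpa [_root_.indefRel] using hP.2.2 c hc _ hx⟩

theorem IsZpSubmodule.relComp {P : Set (X × Y)} {Q : Set (Y × Z)} (hP : IsZpSubmodule p P)
    (hQ : IsZpSubmodule p Q) : IsZpSubmodule p (relComp Q P) := by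
  refine ⟨⟨0, hP.1, hQ.1⟩, ?_, ?_⟩
  · rintro a ⟨w, h₁, h₂⟩ b ⟨w', h₁', h₂'⟩
    exact ⟨w + w', hP.2.1 _ h₁ _ h₁', hQ.2.1 _ h₂ _ h₂'⟩
  · rintro c hc a ⟨w, h₁, h₂⟩
    exact ⟨c • w, hP.2.2 c hc _ h₁, hQ.2.2 c hc _ h₂⟩

/-- Every vector of the span of a `ℤ_p`-submodule has a nonzero multiple in the submodule. -/
theorem IsZpSubmodule.exists_smul_mem_of_mem_span {P : Set X} (hP : IsZpSubmodule p P) {x : X}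
    (hx : x ∈ Submodule.span ℚ_[p] P) : ∃ c : ℚ_[p], c ≠ 0 ∧ ‖c‖ ≤ 1 ∧ c • x ∈ P := by
  induction hx using Submodule.span_induction with
  | mem x hx => exact ⟨1, one_ne_zero, by simp, by simpa using hx⟩
  | zero => exact ⟨1, one_ne_zero, by simp, by simpa using hP.1⟩
  | add x y _ _ ihx ihy =>
    obtain ⟨c, hc, hc1, hcx⟩ := ihx
    obtain ⟨d, hd, hd1, hdy⟩ := ihy
    refine ⟨c * d, mul_ne_zero hc hd, ?_, ?_⟩
    · rw [norm_mul]
      exact mul_le_one₀ hc1 (norm_nonneg _) hd1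
    · rw [smul_add, mul_smul c d y, mul_comm c d, mul_smul]
      exact hP.2.1 _ (hP.2.2 d hd1 _ hcx) _ (hP.2.2 c hc1 _ hdy)
  | smul a x _ ih =>
    obtain ⟨c, hc, hc1, hcx⟩ := ih
    rcases le_total ‖a‖ 1 with ha | ha
    · exact ⟨c, hc, hc1, by rw [smul_comm]; exact hP.2.2 a ha _ hcx⟩
    · have ha0 : a ≠ 0 := norm_pos_iff.1 (one_pos.trans_le ha)
      refine ⟨c * a⁻¹, mul_ne_zero hc (inv_ne_zero ha0), ?_, ?_⟩
      · rw [norm_mul, norm_inv]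
        exact mul_le_one₀ hc1 (by positivity) (inv_le_one_of_one_le₀ ha)
      · rwa [smul_smul, inv_mul_cancel_right₀ ha0]

theorem IsLatticeSet.relComp [TopologicalSpace X] [TopologicalSpace Y] [TopologicalSpace Z]
    [T2Space Y] {P : Set (X × Y)} {Q : Set (Y × Z)} (hP : IsLatticeSet p P)
    (hQ : IsLatticeSet p Q) : IsLatticeSet p (relComp Q P) := by
  obtain ⟨hPm, hPc, hPs⟩ := hP
  obtain ⟨hQm, hQc, hQs⟩ := hQ
  refine ⟨hPm.relComp hQm, ?_, ?_⟩
  · have himage : _root_.relComp Q P = (fun z : (X × Y) × (Y × Z) => (z.1.1, z.2.2)) ''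
        ((P ×ˢ Q) ∩ {z | z.1.2 = z.2.1}) := by
      ext ⟨x, y⟩
      constructor
      · rintro ⟨w, h₁, h₂⟩
        exact ⟨((x, w), (w, y)), ⟨⟨h₁, h₂⟩, rfl⟩, rfl⟩
      · rintro ⟨⟨⟨x', w⟩, ⟨w', y'⟩⟩, ⟨⟨h₁, h₂⟩, h⟩, heq⟩
        simp only [Set.mem_ofPred_eq, Prod.mk.injEq] at h heq
        obtain ⟨rfl, rfl⟩ := heq
        subst h
        exact ⟨w, h₁, h₂⟩
    rw [himage]
    exact ((hPc.prod hQc).inter_right (isClosed_eq (by fun_prop) (by fun_prop))).image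
      (by fun_prop)
  · refine Submodule.eq_top_iff'.2 fun z => ?_
    obtain ⟨c, hc, hc1, hcP⟩ := hPm.exists_smul_mem_of_mem_span (x := (z.1, (0 : Y)))
      (hPs ▸ Submodule.mem_top)
    obtain ⟨d, hd, hd1, hdQ⟩ := hQm.exists_smul_mem_of_mem_span (x := ((0 : Y), z.2))
      (hQs ▸ Submodule.mem_top)
    refine (Submodule.smul_mem_iff _ (mul_ne_zero hc hd)).1 (Submodule.subset_span ⟨0, ?_, ?_⟩)
    · simpa [mul_comm c d, mul_smul] using hPm.2.2 d hd1 _ hcP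
    · simpa [mul_smul] using hQm.2.2 c hc1 _ hdQ

end Relations

section NormedRelations

variable {X Y Z : Type*} [NormedAddCommGroup X] [NormedSpace ℚ_[p] X]
  [NormedAddCommGroup Y] [NormedSpace ℚ_[p] Y] [ProperSpace Y]
  [NormedAddCommGroup Z] [NormedSpace ℚ_[p] Z]

theorem isCompact_kerRel_relComp [ProperSpace X] {P : Set (X × Y)} {Q : Set (Y × Z)}
    (hP : IsZpSubmodule p P) (hPclosed : IsClosed P) (hQ : IsZpSubmodule p Q)
    (hkerP : IsCompact (kerRel P)) (hkerQ : IsCompact (kerRel Q)) :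
    IsCompact (kerRel (relComp Q P)) := by
  have hfiber : P ∩ ContinuousLinearMap.snd ℚ_[p] X Y ⁻¹' {0} = kerRel P ×ˢ {0} := by
    ext ⟨x, y⟩
    simp +contextual [kerRel, and_congr_left_iff]
  have himage : kerRel (relComp Q P) =
      Prod.fst '' (P ∩ ContinuousLinearMap.snd ℚ_[p] X Y ⁻¹' kerRel Q) := by
    ext x
    simp [kerRel, relComp]
  rw [himage]
  exact (hP.isCompact_inter_preimage hPclosed _ hQ.kerRel hkerQ
    (hfiber ▸ hkerP.prod isCompact_singleton)).image continuous_fst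

theorem isCompact_indefRel_relComp [ProperSpace Z] {P : Set (X × Y)} {Q : Set (Y × Z)}
    (hP : IsZpSubmodule p P) (hQ : IsZpSubmodule p Q) (hQclosed : IsClosed Q)
    (hindefP : IsCompact (indefRel P))
    (hindefQ : IsCompact (indefRel Q)) : IsCompact (indefRel (relComp Q P)) := by
  have hfiber : Q ∩ ContinuousLinearMap.fst ℚ_[p] Y Z ⁻¹' {0} = {0} ×ˢ indefRel Q := by
    ext ⟨y, z⟩
    simp +contextual [indefRel, and_comm]
  have himage : indefRel (relComp Q P) =
      Prod.snd '' (Q ∩ ContinuousLinearMap.fst ℚ_[p] Y Z ⁻¹' indefRel P) := by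
    ext z
    simp [indefRel, relComp, and_comm]
  rw [himage]
  exact (hQ.isCompact_inter_preimage hQclosed _ hP.indefRel hindefP
    (hfiber ▸ isCompact_singleton.prod hindefQ)).image continuous_snd

end NormedRelations

end ZpSubmodule

/-- **Nazarov's theorem (compactness and lattices).** Let `P ⊆ V ⊕ W`, `Q ⊆ W ⊕ Y` be
self-dual `ℤ_p`-submodules. (a) If `ker P`, `indef P`, `ker Q`, `indef Q` are compact, then
`ker (QP)` and `indef (QP)` are compact. (b) If moreover `P` and `Q` are lattices, then `QP`
is a lattice in `V ⊕ Y`. -/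
theorem nazarov_compactness_and_lattices (p : ℕ) [Fact p.Prime] (n m l : ℕ)
    (hn : 1 ≤ n) (hm : 1 ≤ m) (hl : 1 ≤ l)
    (P : Set (SpV p n × SpV p m)) (Q : Set (SpV p m × SpV p l))
    (hPmod : IsZpSubmodule p P) (hQmod : IsZpSubmodule p Q)
    (hP : IsSelfDual p (BminusGen p (Bform p n) (Bform p m)) P)
    (hQ : IsSelfDual p (BminusGen p (Bform p m) (Bform p l)) Q) :
    ((IsCompact (kerRel P) ∧ IsCompact (indefRel P) ∧
        IsCompact (kerRel Q) ∧ IsCompact (indefRel Q)) →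
      IsCompact (kerRel (relComp Q P)) ∧ IsCompact (indefRel (relComp Q P))) ∧
    ((IsLatticeSet p P ∧ IsLatticeSet p Q) → IsLatticeSet p (relComp Q P)) := by
  exact ⟨fun ⟨hkerP, hindefP, hkerQ, hindefQ⟩ =>
    ⟨isCompact_kerRel_relComp hPmod (hP.isClosed (continuous_BminusGen_Bform n m)) hQmod
      hkerP hkerQ,
    isCompact_indefRel_relComp hPmod hQmod (hQ.isClosed (continuous_BminusGen_Bform m l))
      hindefP hindefQ⟩,
    fun ⟨hPlat, hQlat⟩ => hPlat.relComp hQlat⟩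
end

section
/- If R_j, R are ℤ_p-submodules of ℚ_p^n and R_j ↗ R, then for all sufficiently large j one has (R_j)_↓ ⊆ R_↓ and (R_j)^↑ ⊇ R^↑. In particular, a ↗-convergent sequence of ℚ_p-linear subspaces is eventually constant. -/
open scoped BigOperators

/-- The convergence `R_j ↗ R` of sets in a normed space: (i) every compact subset of `R` is
eventually contained in `R_j`; (ii) for every `ε > 0`, `R_j` is eventually contained in the
`ε`-neighborhood of `R`. -/
def ConvUp {X : Type*} [SeminormedAddCommGroup X] (Rs : ℕ → Set X) (R : Set X) : Prop :=
  (∀ S : Set X, S ⊆ R → IsCompact S → ∃ J : ℕ, ∀ j : ℕ, J ≤ j → S ⊆ Rs j) ∧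
  (∀ ε : ℝ, 0 < ε → ∃ J : ℕ, ∀ j : ℕ, J ≤ j → ∀ x ∈ Rs j, ∃ r ∈ R, ‖x - r‖ ≤ ε)

/-- The largest `ℚ_p`-linear subspace `R_↓` contained in a `ℤ_p`-submodule `R`:
the set of `x` whose full `ℚ_p`-line lies inside `R`. -/
def Rdown (p : ℕ) [Fact p.Prime] {X : Type*} [AddCommGroup X] [Module ℚ_[p] X]
    (R : Set X) : Set X :=
  {x | ∀ c : ℚ_[p], c • x ∈ R}

/-- A `ℚ_p`-linear subspace, as a set. -/
def IsLinSubspace (p : ℕ) [Fact p.Prime] {X : Type*} [AddCommGroup X] [Module ℚ_[p] X]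
    (S : Set X) : Prop :=
  (0 : X) ∈ S ∧ (∀ x ∈ S, ∀ y ∈ S, x + y ∈ S) ∧ ∀ c : ℚ_[p], ∀ x ∈ S, c • x ∈ S

section ZpSubmodule

variable {p : ℕ} [Fact p.Prime] {X : Type*}

theorem IsZpSubmodule.sum_smul_mem [AddCommGroup X] [Module ℚ_[p] X] {P : Set X}
    (hP : IsZpSubmodule p P) {ι : Type*} (s : Finset ι) (c : ι → ℚ_[p]) (f : ι → X)
    (hc : ∀ i ∈ s, ‖c i‖ ≤ 1) (hf : ∀ i ∈ s, f i ∈ P) : ∑ i ∈ s, c i • f i ∈ P :=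
  Finset.sum_induction _ (· ∈ P) (fun _ _ hx hy => hP.2.1 _ hx _ hy) hP.1
    fun i hi => hP.2.2 _ (hc i hi) _ (hf i hi)

variable [NormedAddCommGroup X] [NormedSpace ℚ_[p] X]

/-- A `ℤ_p`-submodule of a finite-dimensional space is a neighborhood of `0` in its span. -/
theorem IsZpSubmodule.exists_forall_mem_span_norm_lt [FiniteDimensional ℚ_[p] X] {P : Set X}
    (hP : IsZpSubmodule p P) :
    ∃ δ : ℝ, 0 < δ ∧ ∀ w ∈ Submodule.span ℚ_[p] P, ‖w‖ < δ → w ∈ P := by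
  obtain ⟨f, hfP, hspan, hli⟩ := Submodule.exists_fun_fin_finrank_span_eq ℚ_[p] P
  let b := Module.Basis.span hli
  have hcont : Continuous b.equivFun :=
    LinearMap.continuous_of_finiteDimensional b.equivFun.toLinearMap
  obtain ⟨δ, hδ, hball⟩ := Metric.continuousAt_iff.1 (hcont.continuousAt (x := 0)) 1 one_pos
  refine ⟨δ, hδ, fun w hw hwδ => ?_⟩
  rw [← hspan] at hw
  have hlt : ‖b.equivFun ⟨w, hw⟩‖ < 1 := by
    simpa using hball (x := ⟨w, hw⟩) (by simpa using hwδ)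
  have hsum : w = ∑ i, b.equivFun ⟨w, hw⟩ i • f i := by
    simpa [b, Module.Basis.span_apply] using congrArg Subtype.val (b.sum_equivFun ⟨w, hw⟩).symm
  rw [hsum]
  exact hP.sum_smul_mem _ _ _ (fun i _ => (norm_le_pi_norm _ i).trans hlt.le) fun i _ => hfP i

/-- A vector whose line stays within bounded distance of a finite-dimensional subspace lies
in that subspace. -/
theorem Submodule.mem_of_forall_exists_norm_smul_sub_le {𝕜 E : Type*}
    [NontriviallyNormedField 𝕜] [CompleteSpace 𝕜] [NormedAddCommGroup E] [NormedSpace 𝕜 E]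
    (W : Submodule 𝕜 E) [FiniteDimensional 𝕜 W] {x : E} {ε : ℝ}
    (h : ∀ c : 𝕜, ∃ w ∈ W, ‖c • x - w‖ ≤ ε) : x ∈ W := by
  rw [← SetLike.mem_coe, ← W.closed_of_finiteDimensional.closure_eq, Metric.mem_closure_iff]
  intro e he
  obtain ⟨c, hc⟩ := NormedField.exists_lt_norm 𝕜 (max 0 (ε / e))
  obtain ⟨hc0, hcε⟩ := max_lt_iff.1 hc
  obtain ⟨w, hw, hwε⟩ := h c
  refine ⟨c⁻¹ • w, W.smul_mem _ hw, ?_⟩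
  have hx : x - c⁻¹ • w = c⁻¹ • (c • x - w) := by
    rw [smul_sub, inv_smul_smul₀ (norm_pos_iff.1 hc0)]
  rw [dist_eq_norm, hx, norm_smul, norm_inv, inv_mul_lt_iff₀ hc0]
  exact hwε.trans_lt ((div_lt_iff₀ he).1 hcε)

variable [FiniteDimensional ℚ_[p] X] {Rs : ℕ → Set X} {R : Set X}

theorem ConvUp.exists_forall_rdown_subset (hR : IsZpSubmodule p R) (h : ConvUp Rs R) :
    ∃ J : ℕ, ∀ j : ℕ, J ≤ j → Rdown p (Rs j) ⊆ Rdown p R := by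
  obtain ⟨δ, hδ, hmem⟩ := hR.exists_forall_mem_span_norm_lt
  obtain ⟨J, hJ⟩ := h.2 (δ / 2) (half_pos hδ)
  refine ⟨J, fun j hj x hx c => ?_⟩
  have hxW : x ∈ Submodule.span ℚ_[p] R := by
    refine Submodule.mem_of_forall_exists_norm_smul_sub_le _ (ε := δ / 2) fun c => ?_
    obtain ⟨r, hr, hrc⟩ := hJ j hj _ (hx c)
    exact ⟨r, Submodule.subset_span hr, hrc⟩
  obtain ⟨r, hr, hrc⟩ := hJ j hj _ (hx c)
  have hdiff : c • x - r ∈ R :=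
    hmem _ (sub_mem (Submodule.smul_mem _ c hxW) (Submodule.subset_span hr))
      (hrc.trans_lt (half_lt_self hδ))
  simpa using hR.2.1 _ hdiff _ hr

theorem ConvUp.exists_forall_span_le (h : ConvUp Rs R) :
    ∃ J : ℕ, ∀ j : ℕ, J ≤ j → Submodule.span ℚ_[p] R ≤ Submodule.span ℚ_[p] (Rs j) := by
  obtain ⟨f, hfR, hspan, -⟩ := Submodule.exists_fun_fin_finrank_span_eq ℚ_[p] R
  obtain ⟨J, hJ⟩ := h.1 (Set.range f) (Set.range_subset_iff.2 hfR) (Set.finite_range f).isCompact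
  exact ⟨J, fun j hj => hspan ▸ Submodule.span_mono (hJ j hj)⟩

end ZpSubmodule

theorem IsLinSubspace.coe_span_eq {p : ℕ} [Fact p.Prime] {X : Type*} [AddCommGroup X]
    [Module ℚ_[p] X] {S : Set X} (hS : IsLinSubspace p S) :
    (Submodule.span ℚ_[p] S : Set X) = S :=
  congrArg SetLike.coe <| Submodule.span_eq
    { carrier := S
      zero_mem' := hS.1
      add_mem' := fun {_ _} hx hy => hS.2.1 _ hx _ hy
      smul_mem' := fun c _ hx => hS.2.2 c _ hx : Submodule ℚ_[p] X }

/-- If `R_j ↗ R` (as `ℤ_p`-submodules of `ℚ_p^n`), then for all sufficiently large `j` one has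
`(R_j)_↓ ⊆ R_↓` and `(R_j)^↑ ⊇ R^↑` (where `R^↑` is the `ℚ_p`-linear span). In particular a
`↗`-convergent sequence of `ℚ_p`-linear subspaces is eventually constant. -/
theorem convUp_down_up (p : ℕ) [Fact p.Prime] (n : ℕ)
    (Rs : ℕ → Set (Fin n → ℚ_[p])) (R : Set (Fin n → ℚ_[p]))
    (hmod : ∀ j, IsZpSubmodule p (Rs j)) (hRmod : IsZpSubmodule p R)
    (hconv : ConvUp Rs R) :
    (∃ J : ℕ, ∀ j : ℕ, J ≤ j →
      Rdown p (Rs j) ⊆ Rdown p R ∧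
      (Submodule.span ℚ_[p] R : Set (Fin n → ℚ_[p])) ⊆
        (Submodule.span ℚ_[p] (Rs j) : Set (Fin n → ℚ_[p]))) ∧
    ((∀ j, IsLinSubspace p (Rs j)) →
      ∃ J : ℕ, ∀ j j' : ℕ, J ≤ j → J ≤ j' → Rs j = Rs j') := by
  obtain ⟨J₁, h₁⟩ := hconv.exists_forall_rdown_subset hRmod
  obtain ⟨J₂, h₂⟩ := hconv.exists_forall_span_le (p := p)
  have hdown (j : ℕ) (hj : max J₁ J₂ ≤ j) := h₁ j (le_of_max_le_left hj)
  have hup (j : ℕ) (hj : max J₁ J₂ ≤ j) := h₂ j (le_of_max_le_right hj)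
  refine ⟨⟨max J₁ J₂, fun j hj => ⟨hdown j hj, hup j hj⟩⟩, fun hlin => ⟨max J₁ J₂, ?_⟩⟩
  have heq (j : ℕ) (hj : max J₁ J₂ ≤ j) : Rs j = Rdown p R := by
    refine Set.Subset.antisymm (fun x hx => hdown j hj fun c => (hlin j).2.2 c x hx) fun x hx => ?_
    rw [← (hlin j).coe_span_eq]
    exact hup j hj (Submodule.subset_span (by simpa using hx 1))
  exact fun j j' hj hj' => (heq j hj).trans (heq j' hj').symm
end

section
/- Let R_j, R be ℤ_p-submodules of ℚ_p^n with R_j ↗ R. (a) For any ℚ_p-linear subspace L ⊆ ℚ_p^n, one has (L ∩ R_j) ↗ (L ∩ R). (b) For any ℚ_p-linear subspace M ⊆ ℚ_p^n, letting π : ℚ_p^n → ℚ_p^n/M denote the natural quotient map and equipping ℚ_p^n/M with the quotient norm, one has π(R_j) ↗ π(R). -/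
open scoped BigOperators

namespace IsZpSubmodule

variable {p : ℕ} [Fact p.Prime] {X Y : Type*} [AddCommGroup X] [Module ℚ_[p] X]
  [AddCommGroup Y] [Module ℚ_[p] Y]

theorem image {P : Set X} (hP : IsZpSubmodule p P) (f : X →ₗ[ℚ_[p]] Y) :
    IsZpSubmodule p (f '' P) := by
  obtain ⟨h0, hadd, hsmul⟩ := hP
  refine ⟨⟨0, h0, map_zero f⟩, ?_, ?_⟩
  · rintro _ ⟨x, hx, rfl⟩ _ ⟨y, hy, rfl⟩
    exact ⟨x + y, hadd x hx y hy, map_add f x y⟩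
  · rintro c hc _ ⟨x, hx, rfl⟩
    exact ⟨c • x, hsmul c hc x hx, map_smul f c x⟩

theorem neg_mem {P : Set X} (hP : IsZpSubmodule p P) {x : X} (hx : x ∈ P) : -x ∈ P := by
  simpa using hP.2.2 (-1) (by simp) x hx

/-- The integral vectors `c ∈ ℤ_p^n` whose image under a linear map `f` on `ℚ_p^n` lies in a
given `ℤ_p`-submodule. -/
def integralComap {n : ℕ} {P : Set X} (hP : IsZpSubmodule p P)
    (f : (Fin n → ℚ_[p]) →ₗ[ℚ_[p]] X) : Submodule ℤ_[p] (Fin n → ℤ_[p]) where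
  carrier := {c | f (fun i => (c i : ℚ_[p])) ∈ P}
  zero_mem' := by
    change f 0 ∈ P
    simpa using hP.1
  add_mem' {a b} ha hb := by
    change f ((fun i => (a i : ℚ_[p])) + fun i => (b i : ℚ_[p])) ∈ P
    rw [map_add]
    exact hP.2.1 _ ha _ hb
  smul_mem' c a ha := by
    change f ((c : ℚ_[p]) • fun i => (a i : ℚ_[p])) ∈ P
    rw [map_smul]
    exact hP.2.2 _ c.2 _ ha

theorem mem_integralComap {n : ℕ} {P : Set X} (hP : IsZpSubmodule p P)
    (f : (Fin n → ℚ_[p]) →ₗ[ℚ_[p]] X) (c : Fin n → ℤ_[p]) :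
    c ∈ hP.integralComap f ↔ f (fun i => (c i : ℚ_[p])) ∈ P := Iff.rfl

end IsZpSubmodule

section Padic

variable {p : ℕ} [Fact p.Prime]

theorem Padic.exists_norm_p_pow_lt {ε : ℝ} (hε : 0 < ε) : ∃ k : ℕ, ‖(p : ℚ_[p])‖ ^ k < ε :=
  exists_pow_lt_of_lt_one hε Padic.norm_p_lt_one

theorem Padic.prime_ne_zero : (p : ℚ_[p]) ≠ 0 :=
  Nat.cast_ne_zero.2 (Fact.out : p.Prime).ne_zero

theorem exists_norm_p_pow_smul_le_one {X : Type*} [SeminormedAddCommGroup X]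
    [NormedSpace ℚ_[p] X] (B : ℝ) :
    ∃ N : ℕ, ∀ x : X, ‖x‖ ≤ B → ‖(p : ℚ_[p]) ^ N • x‖ ≤ 1 := by
  have hB : 0 < |B| + 1 := by positivity
  obtain ⟨N, hN⟩ := Padic.exists_norm_p_pow_lt (p := p) (inv_pos.2 hB)
  refine ⟨N, fun x hx => ?_⟩
  calc ‖(p : ℚ_[p]) ^ N • x‖ = ‖(p : ℚ_[p])‖ ^ N * ‖x‖ := by rw [norm_smul, norm_pow]
    _ ≤ (|B| + 1)⁻¹ * (|B| + 1) := by
      gcongr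
      linarith [le_abs_self B]
    _ = 1 := inv_mul_cancel₀ hB.ne'

theorem exists_padicInt_coe_eq {n : ℕ} {x : Fin n → ℚ_[p]} (hx : ‖x‖ ≤ 1) :
    ∃ c : Fin n → ℤ_[p], (fun i => (c i : ℚ_[p])) = x :=
  ⟨fun i => ⟨x i, (norm_le_pi_norm x i).trans hx⟩, rfl⟩

/-- A point of `L` close to a `ℤ_p`-submodule `R` is close to `L ∩ R`. -/
theorem exists_forall_mem_inter_norm_sub_le {n : ℕ} {R : Set (Fin n → ℚ_[p])}
    (hR : IsZpSubmodule p R) (L : Submodule ℚ_[p] (Fin n → ℚ_[p])) {ε : ℝ} (hε : 0 < ε) :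
    ∃ δ : ℝ, 0 < δ ∧ ∀ x ∈ L, ∀ r ∈ R, ‖x - r‖ ≤ δ →
      ∃ s ∈ (L : Set (Fin n → ℚ_[p])) ∩ R, ‖x - s‖ ≤ ε := by
  have hp0 : (p : ℚ_[p]) ≠ 0 := Padic.prime_ne_zero
  have hp1 : ‖(p : ℚ_[p])‖ ≤ 1 := Padic.norm_p_lt_one.le
  let P : ℕ → Set (Fin n → ℚ_[p]) :=
    fun m => {x | ∃ l ∈ L, ‖l‖ ≤ 1 ∧ (p : ℚ_[p]) ^ m • x - l ∈ R}
  have hP : ∀ m, IsZpSubmodule p (P m) := by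
    refine fun m => ⟨⟨0, L.zero_mem, by simp, by simpa using hR.1⟩, ?_, ?_⟩
    · rintro x ⟨l, hl, hl1, hx⟩ y ⟨l', hl', hl1', hy⟩
      refine ⟨l + l', L.add_mem hl hl',
        (IsUltrametricDist.norm_add_le_max l l').trans (max_le hl1 hl1'), ?_⟩
      convert hR.2.1 _ hx _ hy using 1
      module
    · rintro c hc x ⟨l, hl, hl1, hx⟩
      refine ⟨c • l, L.smul_mem c hl, ?_, ?_⟩
      · rw [norm_smul]
        exact mul_le_one₀ hc (norm_nonneg l) hl1
      · convert hR.2.2 c hc _ hx using 1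
        module
  have hPmono : Monotone P := by
    refine monotone_nat_of_le_succ fun m => ?_
    rintro x ⟨l, hl, hl1, hx⟩
    refine ⟨(p : ℚ_[p]) • l, L.smul_mem _ hl, ?_, ?_⟩
    · rw [norm_smul]
      exact mul_le_one₀ hp1 (norm_nonneg l) hl1
    · convert hR.2.2 _ hp1 _ hx using 1
      rw [pow_succ']
      module
  obtain ⟨m₀, hm₀⟩ := monotone_stabilizes_iff_noetherian.2
    (inferInstance : IsNoetherian ℤ_[p] (Fin n → ℤ_[p]))
    ⟨fun m => (hP m).integralComap LinearMap.id, fun _ _ h _ hc => hPmono h hc⟩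
  obtain ⟨k, hk⟩ := Padic.exists_norm_p_pow_lt (p := p) hε
  refine ⟨‖(p : ℚ_[p])‖ ^ (k + m₀), pow_pos (norm_pos_iff.2 hp0) _, fun x hx r hr hxr => ?_⟩
  have hunit : ‖((p : ℚ_[p]) ^ (k + m₀))⁻¹ • (x - r)‖ ≤ 1 := by
    rw [norm_smul, norm_inv, norm_pow]
    exact inv_mul_le_one_of_le₀ hxr (by positivity)
  obtain ⟨c, hc⟩ := exists_padicInt_coe_eq hunit
  obtain ⟨N, hN⟩ := exists_norm_p_pow_smul_le_one (p := p) (X := Fin n → ℚ_[p]) ‖x‖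
  have hpow (N : ℕ) : ‖(p : ℚ_[p]) ^ N‖ ≤ 1 := by
    rw [norm_pow]
    exact pow_le_one₀ (norm_nonneg _) hp1
  have hcN : c ∈ (hP (N + (k + m₀))).integralComap LinearMap.id := by
    rw [IsZpSubmodule.mem_integralComap, hc]
    refine ⟨(p : ℚ_[p]) ^ N • x, L.smul_mem _ hx, hN x le_rfl, ?_⟩
    convert hR.neg_mem (hR.2.2 _ (hpow N) r hr) using 1
    rw [LinearMap.id_apply, pow_add _ N, mul_smul, smul_inv_smul₀ (pow_ne_zero _ hp0)]
    module
  have hcm : c ∈ (hP m₀).integralComap LinearMap.id := (hm₀ (N + (k + m₀)) (by lia)).ge hcN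
  rw [IsZpSubmodule.mem_integralComap, hc] at hcm
  obtain ⟨l, hl, hl1, hlR⟩ := hcm
  refine ⟨x - (p : ℚ_[p]) ^ k • l, ⟨L.sub_mem hx (L.smul_mem _ hl), ?_⟩, ?_⟩
  · convert hR.2.1 r hr _ (hR.2.2 _ (hpow k) _ hlR) using 1
    rw [LinearMap.id_apply, smul_sub, smul_smul, ← pow_add, smul_inv_smul₀ (pow_ne_zero _ hp0)]
    module
  · rw [sub_sub_cancel, norm_smul, norm_pow]
    exact (mul_le_of_le_one_right (by positivity) hl1).trans hk.le

/-- A bounded part of the image `π(R)` in a quotient of `ℚ_p^n` is contained in `π(Q)` for every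
`ℤ_p`-submodule `Q` containing a suitable finite subset of `R`. -/
theorem exists_finite_subset_forall_image_mkQ {n : ℕ} {R : Set (Fin n → ℚ_[p])}
    (hR : IsZpSubmodule p R) (M : Submodule ℚ_[p] (Fin n → ℚ_[p]))
    {S : Set ((Fin n → ℚ_[p]) ⧸ M)} (hSR : S ⊆ M.mkQ '' R) {B : ℝ} (hB : ∀ s ∈ S, ‖s‖ ≤ B) :
    ∃ F ⊆ R, F.Finite ∧ ∀ Q, IsZpSubmodule p Q → F ⊆ Q → S ⊆ M.mkQ '' Q := by
  obtain ⟨N, hN⟩ := exists_norm_p_pow_smul_le_one (p := p) (X := Fin n → ℚ_[p]) (B + 1)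
  have hpN : (p : ℚ_[p]) ^ N ≠ 0 := pow_ne_zero _ Padic.prime_ne_zero
  let f : (Fin n → ℚ_[p]) →ₗ[ℚ_[p]] (Fin n → ℚ_[p]) ⧸ M := ((p : ℚ_[p]) ^ N)⁻¹ • M.mkQ
  obtain ⟨G, hG⟩ := IsNoetherian.noetherian ((hR.image M.mkQ).integralComap f)
  have hlift : ∀ c ∈ G, ∃ r ∈ R, M.mkQ r = f fun i => (c i : ℚ_[p]) := fun c hc =>
    hG.le (Submodule.subset_span hc)
  choose! g hgR hg using hlift
  refine ⟨g '' G, Set.image_subset_iff.2 hgR, G.finite_toSet.image g, fun Q hQ hF s hs => ?_⟩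
  have hle : (hR.image M.mkQ).integralComap f ≤ (hQ.image M.mkQ).integralComap f := by
    rw [← hG, Submodule.span_le]
    exact fun c hc => ⟨g c, hF ⟨c, hc, rfl⟩, hg c hc⟩
  obtain ⟨x, rfl, hx⟩ := Submodule.Quotient.norm_mk_lt s one_pos
  obtain ⟨c, hc⟩ := exists_padicInt_coe_eq (hN x (by linarith [hB _ hs]))
  have hfc : f (fun i => (c i : ℚ_[p])) = Submodule.Quotient.mk x := by
    rw [hc, LinearMap.smul_apply, map_smul, inv_smul_smul₀ hpN, Submodule.mkQ_apply]
  have hcQ : c ∈ (hQ.image M.mkQ).integralComap f := hle <| by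
    rw [IsZpSubmodule.mem_integralComap, hfc]
    exact hSR hs
  rwa [IsZpSubmodule.mem_integralComap, hfc] at hcQ

end Padic

/-- If `R_j ↗ R` (as `ℤ_p`-submodules of `ℚ_p^n`), then (a) for any `ℚ_p`-linear subspace `L`
one has `(L ∩ R_j) ↗ (L ∩ R)`; (b) for any `ℚ_p`-linear subspace `M`, with `π : ℚ_p^n → ℚ_p^n/M`
the quotient map and the quotient equipped with the quotient norm, `π(R_j) ↗ π(R)`. -/
theorem convUp_inter_and_quotient (p : ℕ) [Fact p.Prime] (n : ℕ)
    (Rs : ℕ → Set (Fin n → ℚ_[p])) (R : Set (Fin n → ℚ_[p]))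
    (hmod : ∀ j, IsZpSubmodule p (Rs j)) (hRmod : IsZpSubmodule p R)
    (hconv : ConvUp Rs R)
    (L M : Submodule ℚ_[p] (Fin n → ℚ_[p])) :
    ConvUp (fun j => (L : Set (Fin n → ℚ_[p])) ∩ Rs j) ((L : Set (Fin n → ℚ_[p])) ∩ R) ∧
    ConvUp (fun j => M.mkQ '' Rs j) (M.mkQ '' R) := by
  refine ⟨⟨fun S hS hcomp => ?_, fun ε hε => ?_⟩, ⟨fun S hS hcomp => ?_, fun ε hε => ?_⟩⟩
  · obtain ⟨J, hJ⟩ := hconv.1 S (hS.trans Set.inter_subset_right) hcomp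
    exact ⟨J, fun j hj => Set.subset_inter (hS.trans Set.inter_subset_left) (hJ j hj)⟩
  · obtain ⟨δ, hδ, h⟩ := exists_forall_mem_inter_norm_sub_le hRmod L hε
    obtain ⟨J, hJ⟩ := hconv.2 δ hδ
    refine ⟨J, fun j hj x hx => ?_⟩
    obtain ⟨r, hr, hxr⟩ := hJ j hj x hx.2
    exact h x hx.1 r hr hxr
  · obtain ⟨B, hB⟩ := hcomp.isBounded.exists_norm_le
    obtain ⟨F, hFR, hFfin, hF⟩ := exists_finite_subset_forall_image_mkQ hRmod M hS hB
    obtain ⟨J, hJ⟩ := hconv.1 F hFR hFfin.isCompact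
    exact ⟨J, fun j hj => hF _ (hmod j) (hJ j hj)⟩
  · obtain ⟨J, hJ⟩ := hconv.2 ε hε
    refine ⟨J, fun j hj => ?_⟩
    rintro _ ⟨x, hx, rfl⟩
    obtain ⟨r, hr, hxr⟩ := hJ j hj x hx
    refine ⟨M.mkQ r, ⟨r, hr, rfl⟩, ?_⟩
    rw [← map_sub]
    exact (Submodule.Quotient.norm_mk_le M (x - r)).trans hxr
end

section
/- Corners of p-adic orthogonal matrices: for every m×m matrix A with entries in ℤ_p there exist an integer N ≥ 0 and matrices B (m×N), C (N×m), D (N×N) with entries in ℤ_p such that the block matrix M = [[A, B], [C, D]] of size (m+N)×(m+N) satisfies MᵗM = 1, i.e. M ∈ O(m+N, ℤ_p). -/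
open Matrix

namespace PadicInt

/-- Every `p`-adic integer is a sum of four squares. -/
theorem exists_sum_four_squares {p : ℕ} [Fact p.Prime] (x : ℤ_[p]) :
    ∃ q : Fin 4 → ℤ_[p], ∑ i, q i ^ 2 = x := by
  have hclosed : IsClosed (Set.range fun q : Fin 4 → ℤ_[p] => ∑ i, q i ^ 2) :=
    (isCompact_range (by fun_prop)).isClosed
  have hnat : Set.range (Nat.cast : ℕ → ℤ_[p]) ⊆
      Set.range fun q : Fin 4 → ℤ_[p] => ∑ i, q i ^ 2 := by
    rintro _ ⟨n, rfl⟩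
    obtain ⟨a, b, c, d, rfl⟩ := Nat.sum_four_squares n
    exact ⟨![a, b, c, d], by simp [Fin.sum_univ_four]⟩
  exact closure_minimal hnat hclosed (denseRange_natCast x)

end PadicInt

namespace Matrix

variable {R : Type*} [CommRing R]

/-- The Eichler transformation attached to a matrix `F` with totally isotropic column space:
it is orthogonal, over any commutative ring. -/
theorem transpose_mul_self_eichler {m n : Type*} [Fintype m] [Fintype n] [DecidableEq m]
    [DecidableEq n] {F : Matrix n m R} (hF : Fᵀ * F = 0) :
    (fromBlocks (1 : Matrix (m ⊕ m) (m ⊕ m) R) (fromRows (-Fᵀ) (-Fᵀ)) (fromCols F F)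
        (1 - F * Fᵀ))ᵀ *
      fromBlocks (1 : Matrix (m ⊕ m) (m ⊕ m) R) (fromRows (-Fᵀ) (-Fᵀ)) (fromCols F F)
        (1 - F * Fᵀ) = 1 := by
  have hFX (X : Matrix m n R) : Fᵀ * (F * X) = 0 := by rw [← Matrix.mul_assoc, hF, Matrix.zero_mul]
  rw [fromBlocks_transpose, fromBlocks_multiply]
  refine Eq.trans ?_ fromBlocks_one
  congr 1
  · simp [transpose_fromCols, hF]
  · simp [transpose_fromCols, fromRows_mul, Matrix.mul_sub, hFX, ← fromRows_zero]
    ext (i | i) j <;> simp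
  · simp [transpose_fromRows, mul_fromCols, Matrix.sub_mul, Matrix.mul_assoc, hF]
    ext i (j | j) <;> simp
  · simp [transpose_fromRows, fromCols_mul_fromRows, Matrix.sub_mul, Matrix.mul_sub,
      Matrix.mul_assoc, hFX]

/-- If some square submatrix of an orthogonal matrix is `A`, then `A` is the upper left corner of
an orthogonal matrix. -/
theorem exists_fromBlocks_orthogonal_of_submatrix {ι : Type*} [Fintype ι] [DecidableEq ι] {m : ℕ}
    {M : Matrix ι ι R} (hM : Mᵀ * M = 1) {r c : Fin m → ι} (hr : r.Injective)
    (hc : c.Injective) :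
    ∃ (N : ℕ) (B : Matrix (Fin m) (Fin N) R) (C : Matrix (Fin N) (Fin m) R)
      (D : Matrix (Fin N) (Fin N) R),
      (fromBlocks (M.submatrix r c) B C D)ᵀ * fromBlocks (M.submatrix r c) B C D = 1 := by
  classical
  have hext {f : Fin m → ι} (hf : f.Injective) :
      ∃ e : Fin m ⊕ Fin (Fintype.card ι - m) ≃ ι, ∀ i, e (Sum.inl i) = f i := by
    have hcard : Fintype.card ↥(Set.range f)ᶜ = Fintype.card ι - m := by
      rw [Fintype.card_compl_set, Set.card_range_of_injective hf, Fintype.card_fin]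
    exact ⟨((Equiv.ofInjective f hf).sumCongr (Fintype.equivFinOfCardEq hcard).symm).trans
      (Equiv.Set.sumCompl _), fun i => by simp⟩
  obtain ⟨e, he⟩ := hext hr
  obtain ⟨d, hd⟩ := hext hc
  have hcorner : M.submatrix r c = (M.submatrix e d).toBlocks₁₁ := by
    ext i j
    simp [toBlocks₁₁, he, hd]
  refine ⟨_, (M.submatrix e d).toBlocks₁₂, (M.submatrix e d).toBlocks₂₁,
    (M.submatrix e d).toBlocks₂₂, ?_⟩
  rw [hcorner, fromBlocks_toBlocks, transpose_submatrix, submatrix_mul_equiv, hM,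
    submatrix_one_equiv]

/-- If `-1` is a sum of squares in `R`, every square matrix over `R` is the upper left corner of
an orthogonal matrix. -/
theorem exists_fromBlocks_orthogonal {κ : Type*} [Fintype κ] {q : κ → R}
    (hq : ∑ k, q k ^ 2 = -1) {m : ℕ} (A : Matrix (Fin m) (Fin m) R) :
    ∃ (N : ℕ) (B : Matrix (Fin m) (Fin N) R) (C : Matrix (Fin N) (Fin m) R)
      (D : Matrix (Fin N) (Fin N) R),
      (fromBlocks A B C D)ᵀ * fromBlocks A B C D = 1 := by
  classical
  let F : Matrix (Fin m ⊕ Fin m × κ) (Fin m) R :=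
    fromRows A (of fun i j => q i.2 * A i.1 j)
  have hF : Fᵀ * F = 0 := by
    ext i j
    have h (x : Fin m) : ∑ k, q k * A x i * (q k * A x j) = -(A x i * A x j) := by
      rw [← neg_one_mul, ← hq, Finset.sum_mul]
      exact Finset.sum_congr rfl fun k _ => by ring
    simp [F, mul_apply, Fintype.sum_prod_type, h]
  exact exists_fromBlocks_orthogonal_of_submatrix (transpose_mul_self_eichler hF)
    (r := Sum.inr ∘ Sum.inl) (c := Sum.inl ∘ Sum.inl)
    (Sum.inr_injective.comp Sum.inl_injective) (Sum.inl_injective.comp Sum.inl_injective)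

end Matrix



/-- **Corners of p-adic orthogonal matrices.** For every `m × m` matrix `A` with entries in
`ℤ_p` there exist `N ≥ 0` and matrices `B` (`m × N`), `C` (`N × m`), `D` (`N × N`) over `ℤ_p`
such that the block matrix `M = [[A, B], [C, D]]` is orthogonal: `Mᵗ * M = 1`. -/
theorem corners_of_padic_orthogonal_matrices (p : ℕ) [Fact p.Prime] (m : ℕ)
    (A : Matrix (Fin m) (Fin m) ℤ_[p]) :
    ∃ (N : ℕ) (B : Matrix (Fin m) (Fin N) ℤ_[p]) (C : Matrix (Fin N) (Fin m) ℤ_[p])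
      (D : Matrix (Fin N) (Fin N) ℤ_[p]),
      (Matrix.fromBlocks A B C D)ᵀ * Matrix.fromBlocks A B C D = 1 := by
  obtain ⟨q, hq⟩ := PadicInt.exists_sum_four_squares (-1 : ℤ_[p])
  exact Matrix.exists_fromBlocks_orthogonal hq A
end
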